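/- arXiv:2211.00536 — 2 statements merged into one kernel-verified Lean document; each statement's English description precedes it below -/
import Mathlib

section
/- For n ≥ 1, the identity Σ_{s=0}^{n-1} C(n-1,s) (n-s)^(n-s-2) (s+1)^(s-1) = 2(n+1)^(n-2) holds. -/
open Finset

open Polynomial in
/-- A polynomial in characteristic zero is determined by its derivative and one value. -/
theorem Polynomial.eq_of_derivative_eq_of_eval_eq {K : Type*} [Field K] [CharZero K]
    {p q : K[X]} (h : derivative p = derivative q) (a : K) (ha : p.eval a = q.eval a) :
    p = q := by
  have hd : derivative (p - q) = 0 := by rw [derivative_sub, h, sub_self]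
  have hc := eq_C_of_derivative_eq_zero hd
  have he : (p - q).eval a = 0 := by rw [eval_sub, ha, sub_self]
  rw [hc, eval_C] at he
  rw [he, C_0] at hc
  exact sub_eq_zero.mp hc

/-- The alternating binomial sum of a power below the `m`-th along `x, x + 1, …` vanishes. -/
theorem alternating_sum_choose_mul_add_pow {R : Type*} [CommRing R] {j m : ℕ} (h : j < m)
    (x : R) :
    ∑ k ∈ range (m + 1), (-1) ^ (m - k) * (m.choose k : R) * (x + k) ^ j = 0 := by
  have := congrFun (fwdDiff_iter_pow_eq_zero_of_lt (R := R) h) x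
  simpa [fwdDiff_iter_eq_sum_shift] using this

open Polynomial in
/-- Abel's binomial theorem, as an identity of polynomials. -/
theorem abel_binomial_polynomial {K : Type*} [Field K] [CharZero K] {x : K}
    (hx : ∀ k : ℕ, x + k ≠ 0) (m : ℕ) :
    ∑ k ∈ range (m + 1),
        C ((m.choose k : K) * (x * (x + k) ^ ((k : ℤ) - 1))) * (X - C (k : K)) ^ (m - k)
      = (X + C x) ^ m := by
  induction m with
  | zero =>
    have hx0 : x ≠ 0 := by simpa using hx 0
    have hC : C x * C x⁻¹ = 1 := by rw [← C_mul, mul_inv_cancel₀ hx0, C_1]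
    simp [hC]
  | succ m ih =>
    refine eq_of_derivative_eq_of_eval_eq ?_ (-x) ?_
    · rw [sum_range_succ, derivative_add, derivative_sum, derivative_X_add_C_pow,
        Nat.add_sub_cancel, ← ih, mul_sum]
      simp only [Nat.sub_self, pow_zero, mul_one, derivative_C, add_zero]
      refine sum_congr rfl fun k hk => ?_
      have hkm : k ≤ m := Nat.lt_succ_iff.mp (mem_range.mp hk)
      rw [derivative_C_mul, derivative_X_sub_C_pow, ← mul_assoc (C _) (C _),
        ← mul_assoc (C _) (C _), ← C_mul, ← C_mul,
        show m + 1 - k - 1 = m - k by lia]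
      congr 2
      have := congrArg (Nat.cast (R := K)) (Nat.choose_mul_succ_eq m k)
      push_cast at this ⊢
      linear_combination -(x * (x + k) ^ ((k : ℤ) - 1)) * this
    · have h := alternating_sum_choose_mul_add_pow (Nat.lt_succ_self m) x
      simp only [eval_finsetSum, eval_mul, eval_C, eval_pow, eval_sub, eval_add, eval_X,
        neg_add_cancel, zero_pow (Nat.succ_ne_zero m)]
      rw [← mul_zero x, ← h, mul_sum]
      refine sum_congr rfl fun k hk => ?_
      have hkm : k ≤ m + 1 := Nat.lt_succ_iff.mp (mem_range.mp hk)
      have hp : (x + k) ^ ((k : ℤ) - 1) * (x + k) ^ (m + 1 - k) = (x + k) ^ m := by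
        rw [← zpow_natCast, ← zpow_natCast, ← zpow_add₀ (hx k)]
        congr 1
        lia
      rw [show -x - (k : K) = -1 * (x + k) by ring, mul_pow, ← hp]
      ring

/-- Abel's binomial theorem `A_m(x, y; -1, 0) = x⁻¹ (x + y + m)^m`. -/
theorem abel_binomial {K : Type*} [Field K] [CharZero K] {x : K}
    (hx : ∀ k : ℕ, x + k ≠ 0) (y : K) (m : ℕ) :
    ∑ k ∈ range (m + 1),
        (m.choose k : K) * (x + k) ^ ((k : ℤ) - 1) * (y + m - k) ^ (m - k)
      = x⁻¹ * (x + y + m) ^ m := by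
  have hx0 : x ≠ 0 := by simpa using hx 0
  have h := congrArg (Polynomial.eval (y + m)) (abel_binomial_polynomial hx m)
  simp only [Polynomial.eval_finsetSum, Polynomial.eval_mul, Polynomial.eval_C,
    Polynomial.eval_pow, Polynomial.eval_sub, Polynomial.eval_add, Polynomial.eval_X] at h
  rw [show x + y + m = y + m + x by ring, ← h, mul_sum]
  refine sum_congr rfl fun k _ => ?_
  field_simp

/-- Abel's identity `A_m(x, y; -1, -1) = (x⁻¹ + y⁻¹) (x + y + m)^(m - 1)`. -/
theorem abel_binomial_symmetric {K : Type*} [Field K] [CharZero K] {x y : K}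
    (hx : ∀ k : ℕ, x + k ≠ 0) (hy : ∀ k : ℕ, y + k ≠ 0) (m : ℕ) (hxy : x + y + m ≠ 0) :
    ∑ k ∈ range (m + 1),
        (m.choose k : K) * (x + k) ^ ((k : ℤ) - 1) * (y + m - k) ^ ((m : ℤ) - k - 1)
      = (x⁻¹ + y⁻¹) * (x + y + m) ^ ((m : ℤ) - 1) := by
  have h₁ := abel_binomial hx y m
  have h₂ := abel_binomial hy x m
  rw [← sum_range_reflect] at h₂
  rw [zpow_sub_one₀ hxy, zpow_natCast, ← mul_assoc, ← div_eq_mul_inv, eq_div_iff hxy, add_mul,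
    ← h₁, add_comm x y, ← h₂, ← sum_add_distrib, sum_mul]
  refine sum_congr rfl fun k hk => ?_
  have hkm : k ≤ m := Nat.lt_succ_iff.mp (mem_range.mp hk)
  have hyk : y + m - k ≠ 0 := by
    have := hy (m - k)
    rwa [Nat.cast_sub hkm, ← add_sub_assoc] at this
  rw [show m + 1 - 1 - k = m - k by lia, Nat.choose_symm hkm, Nat.sub_sub_self hkm,
    Nat.cast_sub hkm, ← add_sub_assoc, Nat.cast_sub hkm,
    show x + (m : K) - (m - k) = x + k by ring, zpow_sub_one₀ (hx k), zpow_sub_one₀ hyk,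
    ← Nat.cast_sub hkm, zpow_natCast, zpow_natCast]
  have := hx k
  field_simp
  ring

/-- **Specialization `A_{n-1}(1,1;-1,-1) = 2(n+1)^{n-2}` of Abel's identity:** for `n ≥ 1`,
`Σ_{s=0}^{n-1} C(n-1,s) (n-s)^(n-s-2) (s+1)^(s-1) = 2(n+1)^(n-2)`, where the powers
are interpreted in `ℚ` (so e.g. `1^{-1} = 1`). -/
theorem abel_specialization (n : ℕ) (hn : 1 ≤ n) :
    ∑ s ∈ Finset.range n,
        ((n - 1).choose s : ℚ) * ((n : ℚ) - s) ^ ((n : ℤ) - s - 2) * ((s : ℚ) + 1) ^ ((s : ℤ) - 1)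
      = 2 * ((n : ℚ) + 1) ^ ((n : ℤ) - 2) := by
  obtain ⟨m, rfl⟩ := Nat.exists_eq_add_of_le' hn
  have h1 : ∀ k : ℕ, (1 : ℚ) + k ≠ 0 := fun k => by positivity
  convert abel_binomial_symmetric h1 h1 m (by positivity) using 1
  · refine sum_congr rfl fun k _ => ?_
    rw [Nat.add_sub_cancel, mul_right_comm, add_comm (k : ℚ) 1]
    push_cast
    rw [add_comm (m : ℚ) 1, show (m : ℤ) + 1 - k - 2 = m - k - 1 by ring]
  · push_cast
    rw [show (m : ℤ) + 1 - 2 = m - 1 by ring, show (m : ℚ) + 1 + 1 = 1 + 1 + m by ring]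
    norm_num
end

section
/- Under the probabilistic parking protocol with parameter p on n spots, given that the uniformly random preference vector α ∈ [n]^n is a parking function, the conditional probability that the last car prefers spot j equals 2/(n+1) − (1/(n+1)^(n−1))·[p·Σ_{s=n−j+1}^{n−1} C(n−1,s)(n−s)^(n−s−2)(s+1)^(s−1) + (1−p)·Σ_{s=0}^{n−j−1} C(n−1,s)(n−s)^(n−s−2)(s+1)^(s−1)]. -/
open Finset

/-- One step of the probabilistic parking protocol on a one-way street with `n` spots:
a car with preference `a` parks there if it is empty; otherwise it moves forward
(if `fwd = true`) or backward (if `fwd = false`), parking at the nearest empty spot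
in that direction, and fails (`none`) if there is none. -/
def linPark (n : ℕ) (occ : Finset (Fin n)) (a : Fin n) (fwd : Bool) : Option (Fin n) :=
  if a ∉ occ then some a
  else
    let cand : Finset (Fin n) := Finset.univ.filter fun s => (if fwd then a < s else s < a) ∧ s ∉ occ
    if h : cand.Nonempty then some (if fwd then cand.min' h else cand.max' h) else none

/-- Run the protocol for all `m` cars (in order), given preferences `α` and coin flips `c`;
returns `none` if some car fails to park. -/
def linRun (n m : ℕ) (α : Fin m → Fin n) (c : Fin m → Bool) : Option (Finset (Fin n)) :=
  (List.finRange m).foldl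
    (fun st i => st.bind fun occ => (linPark n occ (α i) (c i)).map fun s => insert s occ)
    (some ∅)

/-- All `m` cars manage to park. -/
def linParks (n m : ℕ) (α : Fin m → Fin n) (c : Fin m → Bool) : Prop :=
  (linRun n m α c).isSome = true

instance (n m : ℕ) (α : Fin m → Fin n) (c : Fin m → Bool) : Decidable (linParks n m α c) := by
  unfold linParks; infer_instance

/-- Probability of a given vector of coin flips. -/
def coinWeight (p : ℝ) {m : ℕ} (c : Fin m → Bool) : ℝ := ∏ i, if c i then p else 1 - p

/-- The Abel-type summand `C(n−1,s)(n−s)^{n−s−2}(s+1)^{s−1}`, with the powers taken in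
`ℝ` with integer exponents (so e.g. `1^{-1} = 1`). -/
noncomputable def abelTerm (n s : ℕ) : ℝ :=
  ((n - 1).choose s : ℝ) * ((n : ℝ) - s) ^ ((n : ℤ) - s - 2) * ((s : ℝ) + 1) ^ ((s : ℤ) - 1)

/-- `Q_{n,p}(j)`: the (conditional) probability that the last car prefers spot `j ∈ [n]`,
given that all cars park, as established in Theorem 3:
`Q_{n,p}(j) = 2/(n+1) − (1/(n+1)^{n−1})[p·Σ_{s=n−j+1}^{n−1} C(n−1,s)(n−s)^{n−s−2}(s+1)^{s−1}`
`+ (1−p)·Σ_{s=0}^{n−j−1} C(n−1,s)(n−s)^{n−s−2}(s+1)^{s−1}]`. -/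
noncomputable def Qform (n : ℕ) (p : ℝ) (j : ℕ) : ℝ :=
  2 / ((n : ℝ) + 1) - (1 / ((n : ℝ) + 1) ^ (n - 1)) *
    (p * ∑ s ∈ Finset.Icc (n - j + 1) (n - 1), abelTerm n s
      + (1 - p) * ∑ s ∈ Finset.range (n - j), abelTerm n s)

/-- The number `(m+1)^(m-1)` of parking functions of length `m`. -/
def parkCount (m : ℕ) : ℝ := ((m : ℝ) + 1) ^ (m - 1)

lemma parkCount_mul_pow {k n : ℕ} (hk : k ≤ n) (hn : 0 < n) :
    parkCount k * ((k : ℝ) + 1) ^ (n - k) = ((k : ℝ) + 1) ^ (n - 1) := by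
  rcases Nat.eq_zero_or_pos k with rfl | hk0
  · simp [parkCount]
  · rw [parkCount, ← pow_add]
    congr 1
    omega

/-- The alternating sum that makes Abel's identity hold at `y = -(n + 1)`. -/
lemma sum_choose_mul_parkCount_eq_zero {n : ℕ} (hn : 0 < n) :
    ∑ k ∈ range (n + 1),
      (n.choose k : ℝ) * parkCount k * (-((n : ℝ) + 1) + ((n : ℝ) - k)) ^ (n - k) = 0 := by
  have h := congrFun (fwdDiff_iter_pow_eq_zero_of_lt (R := ℝ) (Nat.sub_lt hn one_pos)) 1
  rw [fwdDiff_iter_eq_sum_shift] at h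
  rw [← Pi.zero_apply (M := fun _ : ℝ => ℝ) (1 : ℝ), ← h]
  refine sum_congr rfl fun k hk => ?_
  have hk' : k ≤ n := by simpa [Nat.lt_succ_iff] using hk
  have e : -((n : ℝ) + 1) + ((n : ℝ) - k) = (-1) * ((k : ℝ) + 1) := by ring
  rw [e, mul_pow]
  simp only [zsmul_eq_mul, nsmul_eq_mul, mul_one]
  rw [add_comm (1 : ℝ), ← parkCount_mul_pow hk' hn]
  push_cast
  ring

/-- Abel's binomial identity (with first variable `1`). -/
theorem sum_choose_mul_parkCount_mul_pow (n : ℕ) (y : ℝ) :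
    ∑ k ∈ range (n + 1), (n.choose k : ℝ) * parkCount k * (y + ((n : ℝ) - k)) ^ (n - k)
      = (y + n + 1) ^ n := by
  induction n generalizing y with
  | zero => simp [parkCount]
  | succ n ih =>
    set g : ℝ → ℝ := fun y =>
      ∑ k ∈ range (n + 1 + 1), ((n + 1).choose k : ℝ) * parkCount k *
        (y + (((n + 1 : ℕ) : ℝ) - k)) ^ (n + 1 - k) - (y + ((n + 1 : ℕ) : ℝ) + 1) ^ (n + 1) with hg
    have hd : ∀ y, HasDerivAt g 0 y := by
      intro y
      have h1 : ∀ k ∈ range (n + 1 + 1), HasDerivAt (fun y : ℝ => ((n + 1).choose k : ℝ) *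
          parkCount k * (y + (((n + 1 : ℕ) : ℝ) - k)) ^ (n + 1 - k))
          (((n + 1).choose k : ℝ) * parkCount k *
            (((n + 1 - k : ℕ) : ℝ) * (y + (((n + 1 : ℕ) : ℝ) - k)) ^ (n + 1 - k - 1) * 1)) y :=
        fun k _ => (((hasDerivAt_id y).add_const _).pow _).const_mul _
      have h2 : HasDerivAt (fun y : ℝ => (y + ((n + 1 : ℕ) : ℝ) + 1) ^ (n + 1))
          (((n + 1 : ℕ) : ℝ) * (y + ((n + 1 : ℕ) : ℝ) + 1) ^ (n + 1 - 1) * 1) y :=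
        (((hasDerivAt_id y).add_const _).add_const _).pow _
      refine ((HasDerivAt.fun_sum h1).sub h2).congr_deriv ?_
      rw [sub_eq_zero, sum_range_succ]
      have h3 := ih (y + 1)
      simp only [Nat.sub_self, Nat.cast_zero, zero_mul, mul_zero, add_zero, Nat.add_sub_cancel,
        mul_one]
      have e : y + ((n + 1 : ℕ) : ℝ) + 1 = y + 1 + n + 1 := by push_cast; ring
      rw [e, ← h3, mul_sum]
      refine sum_congr rfl fun k hk => ?_
      have hk' : k ≤ n := by simpa [Nat.lt_succ_iff] using hk
      have h4 : ((n + 1).choose k : ℝ) * ((n + 1 - k : ℕ) : ℝ) = ((n + 1 : ℕ) : ℝ) * n.choose k := by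
        rw [mul_comm ((n + 1 : ℕ) : ℝ)]
        exact_mod_cast (Nat.choose_mul_succ_eq n k).symm
      have e2 : y + (((n + 1 : ℕ) : ℝ) - k) = y + 1 + (n - k) := by push_cast; ring
      have e3 : n + 1 - k - 1 = n - k := by omega
      rw [e2, e3]
      linear_combination parkCount k * (y + 1 + ((n : ℝ) - k)) ^ (n - k) * h4
    have hc := is_const_of_deriv_eq_zero (fun y => (hd y).differentiableAt) (fun y => (hd y).deriv)
      y (-(((n + 1 : ℕ) : ℝ) + 1))
    have h0 : g (-(((n + 1 : ℕ) : ℝ) + 1)) = 0 := by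
      simp only [hg]
      rw [sum_choose_mul_parkCount_eq_zero n.succ_pos]
      ring
    rw [h0, hg] at hc
    exact sub_eq_zero.mp hc

/-- The convolution identity for the numbers `(m+1)^(m-1)`. -/
theorem sum_choose_mul_parkCount_mul_parkCount (n : ℕ) :
    ((n : ℝ) + 2) * ∑ k ∈ range (n + 1), (n.choose k : ℝ) * (parkCount k * parkCount (n - k))
      = 2 * ((n : ℝ) + 2) ^ n := by
  rcases n with _ | n
  · simp [parkCount]
  have key : ∑ k ∈ range (n + 1 + 1),
      ((n + 1).choose k : ℝ) * (parkCount k * parkCount (n + 1 - k)) =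
      ∑ k ∈ range (n + 1 + 1), ((n + 1).choose k : ℝ) * parkCount k *
        (1 + (((n + 1 : ℕ) : ℝ) - k)) ^ (n + 1 - k) -
      (n + 1) * ∑ k ∈ range (n + 1), (n.choose k : ℝ) * parkCount k *
        (2 + ((n : ℝ) - k)) ^ (n - k) := by
    rw [sum_range_succ, sum_range_succ _ (n + 1), mul_sum, add_sub_right_comm, ← sum_sub_distrib]
    congr 1
    · refine sum_congr rfl fun k hk => ?_
      have hk' : k ≤ n := by simpa [Nat.lt_succ_iff] using hk
      have h4 : ((n + 1).choose k : ℝ) * ((n + 1 : ℝ) - k) = (n + 1 : ℝ) * n.choose k := by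
        have := (Nat.choose_mul_succ_eq n k).symm
        rw [← Nat.cast_inj (R := ℝ)] at this
        push_cast [Nat.cast_sub (show k ≤ n + 1 by omega)] at this
        linarith
      obtain ⟨d, rfl⟩ := Nat.exists_eq_add_of_le hk'
      have e3 : k + d + 1 - k = d + 1 := by omega
      have e4 : k + d - k = d := by omega
      simp only [parkCount, e3, e4, Nat.add_sub_cancel] at h4 ⊢
      push_cast at h4 ⊢
      have e1 : (1 : ℝ) + ((k : ℝ) + d + 1 - k) = d + 1 + 1 := by ring
      have e2 : (2 : ℝ) + ((k : ℝ) + d - k) = d + 1 + 1 := by ring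
      rw [e1, e2, pow_succ]
      linear_combination (-((k : ℝ) + 1) ^ (k - 1) * ((d : ℝ) + 1 + 1) ^ d) * h4
    · simp [parkCount]
  rw [key, sum_choose_mul_parkCount_mul_pow, sum_choose_mul_parkCount_mul_pow]
  push_cast
  ring

section Protocol

variable {n m : ℕ}

lemma sum_fin_snoc {A : Type*} [Fintype A] (F : (Fin (m + 1) → A) → ℝ) :
    ∑ α, F α = ∑ β : Fin m → A, ∑ a, F (Fin.snoc β a) := by
  rw [← (Fin.snocEquiv fun _ : Fin (m + 1) => A).sum_comp, Fintype.sum_prod_type, sum_comm]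
  rfl

/-- Probability of a single coin flip. -/
def flipWeight (p : ℝ) (b : Bool) : ℝ := if b then p else 1 - p

lemma coinWeight_snoc (p : ℝ) (c : Fin m → Bool) (b : Bool) :
    coinWeight p (Fin.snoc c b : Fin (m + 1) → Bool) = coinWeight p c * flipWeight p b := by
  simp [coinWeight, flipWeight, Fin.prod_univ_castSucc]

lemma linRun_snoc (α : Fin m → Fin n) (a : Fin n) (c : Fin m → Bool) (b : Bool) :
    linRun n (m + 1) (Fin.snoc α a) (Fin.snoc c b) =
      (linRun n m α c).bind fun occ => (linPark n occ a b).map fun s => insert s occ := by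
  simp [linRun, List.finRange_succ_last, List.foldl_map]

/-- The total weight of the preferences and coin flips for which the first `m` cars all park and
occupy exactly the spots in `S`. -/
noncomputable def parkWeight (n : ℕ) (p : ℝ) (m : ℕ) (S : Finset (Fin n)) : ℝ :=
  ∑ α : Fin m → Fin n, ∑ c : Fin m → Bool,
    coinWeight p c * (if linRun n m α c = some S then 1 else 0)

lemma sum_coinWeight_mul (p : ℝ) (F : Option (Finset (Fin n)) → ℝ) (hF : F none = 0) :
    ∑ α : Fin m → Fin n, ∑ c : Fin m → Bool, coinWeight p c * F (linRun n m α c) =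
      ∑ S, parkWeight n p m S * F (some S) := by
  have h : ∀ o : Option (Finset (Fin n)),
      F o = ∑ S, (if o = some S then 1 else 0) * F (some S) := by
    rintro (_ | S)
    · simp [hF]
    · simp
  simp_rw [parkWeight, sum_mul]
  rw [sum_comm (s := (univ : Finset (Finset (Fin n))))]
  refine sum_congr rfl fun α _ => ?_
  rw [sum_comm (s := (univ : Finset (Finset (Fin n))))]
  refine sum_congr rfl fun c _ => ?_
  rw [h (linRun n m α c), mul_sum]
  exact sum_congr rfl fun S _ => by ring

/-- Conditioning on the spots occupied before the last car arrives. -/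
lemma sum_coinWeight_mul_last (p : ℝ) (F : Fin n → Option (Finset (Fin n)) → ℝ)
    (hF : ∀ a, F a none = 0) :
    ∑ α : Fin (m + 1) → Fin n, ∑ c : Fin (m + 1) → Bool,
        coinWeight p c * F (α (Fin.last m)) (linRun n (m + 1) α c) =
      ∑ S, parkWeight n p m S * ∑ a, ∑ b, flipWeight p b *
        F a ((linPark n S a b).map fun s => insert s S) := by
  refine Eq.trans ?_ (sum_coinWeight_mul p (fun o => ∑ a, ∑ b, flipWeight p b *
    F a (o.bind fun S => (linPark n S a b).map fun s => insert s S)) (by simp [hF]))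
  rw [sum_fin_snoc]
  refine sum_congr rfl fun α _ => ?_
  simp_rw [sum_fin_snoc, coinWeight_snoc, linRun_snoc, Fin.snoc_last]
  rw [sum_comm]
  refine sum_congr rfl fun c _ => ?_
  simp_rw [mul_sum, mul_assoc]

lemma linPark_eq_some_iff {S : Finset (Fin n)} {a s : Fin n} {b : Bool} :
    linPark n S a b = some s ↔ s ∉ S ∧
      if b then a ≤ s ∧ ∀ t, a ≤ t → t < s → t ∈ S else s ≤ a ∧ ∀ t, s < t → t ≤ a → t ∈ S := by
  unfold linPark
  by_cases ha : a ∈ S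
  · have hne : ∀ t, t ∉ S → t ≠ a := fun t ht h => ht (h ▸ ha)
    cases b
    · simp only [ha, not_true_eq_false, if_false, Bool.false_eq_true]
      by_cases h : ({x | x < a ∧ x ∉ S} : Finset (Fin n)).Nonempty
      · rw [dif_pos h, Option.some_inj]
        constructor
        · rintro rfl
          have := max'_mem _ h
          simp only [mem_filter, mem_univ, true_and] at this
          refine ⟨this.2, this.1.le, fun t h1 h2 => ?_⟩
          by_contra ht
          exact absurd (le_max' _ t (by simp [ht, lt_of_le_of_ne h2 (hne t ht)])) (not_le.2 h1)
        · rintro ⟨h1, h2, h3⟩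
          refine le_antisymm (max'_le _ _ _ fun t ht => ?_)
            (le_max' _ s (by simp [h1, lt_of_le_of_ne h2 (hne s h1)]))
          simp only [mem_filter, mem_univ, true_and] at ht
          by_contra hlt
          exact ht.2 (h3 t (not_le.1 hlt) ht.1.le)
      · rw [dif_neg h]
        refine iff_of_false (by simp) ?_
        rintro ⟨h1, h2, -⟩
        exact h ⟨s, by simp [h1, lt_of_le_of_ne h2 (hne s h1)]⟩
    · simp only [ha, not_true_eq_false, if_false, if_true]
      by_cases h : ({x | a < x ∧ x ∉ S} : Finset (Fin n)).Nonempty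
      · rw [dif_pos h, Option.some_inj]
        constructor
        · rintro rfl
          have := min'_mem _ h
          simp only [mem_filter, mem_univ, true_and] at this
          refine ⟨this.2, this.1.le, fun t h1 h2 => ?_⟩
          by_contra ht
          exact absurd (min'_le _ t (by simp [ht, lt_of_le_of_ne h1 (hne t ht).symm])) (not_le.2 h2)
        · rintro ⟨h1, h2, h3⟩
          refine le_antisymm (min'_le _ s (by simp [h1, lt_of_le_of_ne h2 (hne s h1).symm]))
            (le_min' _ _ _ fun t ht => ?_)
          simp only [mem_filter, mem_univ, true_and] at ht
          by_contra hlt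
          exact ht.2 (h3 t ht.1.le (not_le.1 hlt))
      · rw [dif_neg h]
        refine iff_of_false (by simp) ?_
        rintro ⟨h1, h2, -⟩
        exact h ⟨s, by simp [h1, lt_of_le_of_ne h2 (hne s h1).symm]⟩
  · simp only [ha, not_false_eq_true, if_true, Option.some_inj]
    constructor
    · rintro rfl
      refine ⟨ha, ?_⟩
      split_ifs
      · exact ⟨le_rfl, fun t h1 h2 => absurd h2 (not_lt.2 h1)⟩
      · exact ⟨le_rfl, fun t h1 h2 => absurd h1 (not_lt.2 h2)⟩
    · rintro ⟨h1, h2⟩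
      by_contra hne
      split_ifs at h2
      · exact ha (h2.2 a le_rfl (lt_of_le_of_ne h2.1 hne))
      · exact ha (h2.2 a (lt_of_le_of_ne h2.1 (Ne.symm hne)) le_rfl)

/-- The weighted number of preferences with which a car parks in the empty spot `s` when the spots
in `S` are occupied. -/
noncomputable def spotWeight (p : ℝ) (S : Finset (Fin n)) (s : Fin n) : ℝ :=
  p * #{a | a ≤ s ∧ ∀ t, a ≤ t → t < s → t ∈ S} +
    (1 - p) * #{a | s ≤ a ∧ ∀ t, s < t → t ≤ a → t ∈ S}

lemma sum_flipWeight_mul_linPark (p : ℝ) {S : Finset (Fin n)} {s : Fin n} (hs : s ∉ S) :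
    ∑ a, ∑ b, flipWeight p b * (if linPark n S a b = some s then 1 else 0) =
      spotWeight p S s := by
  simp only [linPark_eq_some_iff, hs, not_false_eq_true, true_and, flipWeight, spotWeight,
    Fintype.sum_bool, if_true, Bool.false_eq_true, if_false, sum_add_distrib, ← mul_sum, sum_boole]

lemma parkWeight_succ (p : ℝ) (T : Finset (Fin n)) :
    parkWeight n p (m + 1) T =
      ∑ s ∈ T, parkWeight n p m (T.erase s) * spotWeight p (T.erase s) s := by
  have h := sum_coinWeight_mul_last (m := m) p (fun (_ : Fin n) o => if o = some T then 1 else 0)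
    (by simp)
  rw [parkWeight, h]
  have hind : ∀ S (a : Fin n) b,
      (if (linPark n S a b).map (fun s => insert s S) = some T then (1 : ℝ) else 0) =
      ∑ s ∈ T, if S = T.erase s then (if linPark n S a b = some s then 1 else 0) else 0 := by
    intro S a b
    rcases hr : linPark n S a b with _ | r
    · simp
    have hrS := (linPark_eq_some_iff.1 hr).1
    simp only [Option.map_some, Option.some_inj]
    by_cases hT : insert r S = T
    · subst hT
      rw [sum_eq_single r]
      · simp [hrS]
      · intro s _ hs
        simp [Ne.symm hs]
      · simp
    · rw [if_neg hT, sum_eq_zero]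
      intro s hs
      split_ifs with h1 h2
      · subst h2
        exact absurd (by rw [h1, insert_erase hs]) hT
      all_goals rfl
  simp_rw [hind, mul_sum]
  have hsw : ∀ S : Finset (Fin n), ∑ a, ∑ b, ∑ s ∈ T, parkWeight n p m S * (flipWeight p b *
      if S = T.erase s then (if linPark n S a b = some s then 1 else 0) else 0) =
      ∑ s ∈ T, if S = T.erase s then parkWeight n p m (T.erase s) * spotWeight p (T.erase s) s
        else 0 := by
    intro S
    simp_rw [sum_comm (t := T)]
    refine sum_congr rfl fun s _ => ?_
    split_ifs with hS
    · subst hS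
      rw [← sum_flipWeight_mul_linPark p (notMem_erase s T)]
      simp_rw [mul_sum]
    · simp
  simp_rw [hsw]
  rw [sum_comm]
  simp

lemma parkWeight_zero (p : ℝ) : parkWeight n p 0 ∅ = 1 := by
  simp [parkWeight, linRun, coinWeight]

lemma parkWeight_eq_zero (p : ℝ) {S : Finset (Fin n)} (h : #S ≠ m) : parkWeight n p m S = 0 := by
  induction m generalizing S with
  | zero =>
    have : S ≠ ∅ := by simpa using h
    simp [parkWeight, linRun, this.symm]
  | succ m ih =>
    rw [parkWeight_succ]
    refine sum_eq_zero fun s hs => ?_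
    rw [ih, zero_mul]
    have := card_erase_add_one hs
    omega

lemma filter_erase_of_not {α : Type*} [DecidableEq α] (S : Finset α) (s : α) (q : α → Prop)
    [DecidablePred q] (hs : ¬ q s) : (S.erase s).filter q = S.filter q := by
  rw [filter_erase, erase_eq_of_notMem (by simp [hs])]

lemma spotWeight_filter_lt (p : ℝ) {S : Finset (Fin n)} {e s : Fin n} (he : e ∉ S) (hs : s < e) :
    spotWeight p (S.filter (· < e)) s = spotWeight p S s := by
  unfold spotWeight
  congr 5 <;> ext a <;> simp only [mem_filter, and_congr_right_iff]
  · exact fun _ => ⟨fun h t h1 h2 => (h t h1 h2).1, fun h t h1 h2 => ⟨h t h1 h2, h2.trans hs⟩⟩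
  · refine fun h0 => ⟨fun h t h1 h2 => (h t h1 h2).1, fun h t h1 h2 => ⟨h t h1 h2, ?_⟩⟩
    by_contra hlt
    exact he (h e hs ((not_lt.1 hlt).trans h2))

lemma spotWeight_filter_gt (p : ℝ) {S : Finset (Fin n)} {e s : Fin n} (he : e ∉ S) (hs : e < s) :
    spotWeight p (S.filter (e < ·)) s = spotWeight p S s := by
  unfold spotWeight
  congr 5 <;> ext a <;> simp only [mem_filter, and_congr_right_iff]
  · refine fun h0 => ⟨fun h t h1 h2 => (h t h1 h2).1, fun h t h1 h2 => ⟨h t h1 h2, ?_⟩⟩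
    by_contra hlt
    exact he (h e (h1.trans (not_lt.1 hlt)) hs)
  · exact fun _ => ⟨fun h t h1 h2 => (h t h1 h2).1, fun h t h1 h2 => ⟨h t h1 h2, hs.trans h1⟩⟩

lemma card_filter_lt_add_card_filter_gt {S : Finset (Fin n)} {e : Fin n} (he : e ∉ S) :
    #(S.filter (· < e)) + #(S.filter (e < ·)) = #S := by
  rw [← card_filter_add_card_filter_not (s := S) (· < e)]
  congr 2
  refine filter_congr fun x hx => ?_
  have : x ≠ e := fun h => he (h ▸ hx)
  grind

/-- Cars on the two sides of an empty spot do not interact. -/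
theorem parkWeight_split (p : ℝ) {S : Finset (Fin n)} {e : Fin n} (he : e ∉ S) {a b : ℕ}
    (ha : #(S.filter (· < e)) = a) (hb : #(S.filter (e < ·)) = b) :
    parkWeight n p (a + b) S = ((a + b).choose a : ℝ) *
      (parkWeight n p a (S.filter (· < e)) * parkWeight n p b (S.filter (e < ·))) := by
  obtain ⟨m, hm⟩ : ∃ m, a + b = m := ⟨_, rfl⟩
  induction m generalizing S a b with
  | zero =>
    obtain ⟨rfl, rfl⟩ : a = 0 ∧ b = 0 := by omega
    have hS : S = ∅ := by
      rw [← card_eq_zero, ← card_filter_lt_add_card_filter_gt he, ha, hb]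
    subst hS
    simp [parkWeight_zero]
  | succ m ih =>
    set A := S.filter (· < e) with hA
    set B := S.filter (e < ·) with hB
    have hL : ∀ s ∈ A, parkWeight n p m (S.erase s) * spotWeight p (S.erase s) s =
        (m.choose (a - 1) : ℝ) * (parkWeight n p (a - 1) (A.erase s) * spotWeight p (A.erase s) s) *
          parkWeight n p b B := by
      intro s hs
      have hse : s < e := (mem_filter.1 hs).2
      have he' : e ∉ S.erase s := fun h => he (mem_of_mem_erase h)
      have h1 : (S.erase s).filter (· < e) = A.erase s := by rw [filter_erase]
      have h2 : (S.erase s).filter (e < ·) = B := filter_erase_of_not S s _ (not_lt.2 hse.le)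
      have hc := card_erase_add_one hs
      have := ih he' (a := a - 1) (b := b) (by rw [h1]; omega) (by rw [h2, hb]) (by omega)
      rw [show a - 1 + b = m by omega, h1, h2] at this
      rw [this, ← spotWeight_filter_lt p he' hse, h1]
      ring
    have hR : ∀ s ∈ B, parkWeight n p m (S.erase s) * spotWeight p (S.erase s) s =
        (m.choose a : ℝ) * (parkWeight n p (b - 1) (B.erase s) * spotWeight p (B.erase s) s) *
          parkWeight n p a A := by
      intro s hs
      have hse : e < s := (mem_filter.1 hs).2
      have he' : e ∉ S.erase s := fun h => he (mem_of_mem_erase h)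
      have h1 : (S.erase s).filter (e < ·) = B.erase s := by rw [filter_erase]
      have h2 : (S.erase s).filter (· < e) = A := filter_erase_of_not S s _ (not_lt.2 hse.le)
      have hc := card_erase_add_one hs
      have := ih he' (a := a) (b := b - 1) (by rw [h2, ha]) (by rw [h1]; omega) (by omega)
      rw [show a + (b - 1) = m by omega, h1, h2] at this
      rw [this, ← spotWeight_filter_gt p he' hse, h1]
      ring
    have hdisj : Disjoint A B := by
      rw [Finset.disjoint_left]
      intro x h1 h2
      exact lt_asymm (mem_filter.1 h1).2 (mem_filter.1 h2).2
    have hU : A ∪ B = S := by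
      ext x
      simp only [hA, hB, mem_union, mem_filter]
      grind
    rw [hm, parkWeight_succ]
    conv_lhs => rw [← hU]
    rw [sum_union hdisj]
    simp only [hU]
    rw [sum_congr rfl hL, sum_congr rfl hR, ← sum_mul, ← sum_mul, ← mul_sum, ← mul_sum]
    rcases a with _ | a
    · obtain rfl : b = m + 1 := by omega
      have hA0 : A = ∅ := card_eq_zero.1 ha
      rw [hA0, Nat.add_sub_cancel, sum_empty, ← parkWeight_succ, Nat.choose_zero_right,
        Nat.choose_zero_right]
      ring
    rcases b with _ | b
    · obtain rfl : a = m := by omega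
      have hB0 : B = ∅ := card_eq_zero.1 hb
      rw [hB0, Nat.add_sub_cancel, ← parkWeight_succ]
      simp
    · rw [Nat.add_sub_cancel, Nat.add_sub_cancel, ← parkWeight_succ, ← parkWeight_succ,
        Nat.choose_succ_succ]
      push_cast
      ring

/-- The block of `m` consecutive spots starting at `i`. -/
def spotBlock (n i m : ℕ) : Finset (Fin n) := {x | i ≤ (x : ℕ) ∧ (x : ℕ) < i + m}

lemma mem_spotBlock {i : ℕ} {x : Fin n} :
    x ∈ spotBlock n i m ↔ i ≤ (x : ℕ) ∧ (x : ℕ) < i + m := by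
  simp [spotBlock]

lemma card_spotBlock {i : ℕ} (h : i + m ≤ n) : #(spotBlock n i m) = m := by
  have : (spotBlock n i m).map Fin.valEmbedding = Ico i (i + m) := by
    ext x
    simp only [mem_map, mem_spotBlock, Fin.valEmbedding_apply, mem_Ico]
    exact ⟨by rintro ⟨y, hy, rfl⟩; exact hy, fun hx => ⟨⟨x, by omega⟩, hx, rfl⟩⟩
  rw [← card_map Fin.valEmbedding, this, Nat.card_Ico, Nat.add_sub_cancel_left]

lemma spotWeight_spotBlock_erase (p : ℝ) {i : ℕ} (h : i + (m + 1) ≤ n) {s : Fin n}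
    (hs : s ∈ spotBlock n i (m + 1)) :
    spotWeight p ((spotBlock n i (m + 1)).erase s) s =
      p * (((s : ℕ) - i : ℕ) + 1) + (1 - p) * ((m - ((s : ℕ) - i) : ℕ) + 1) := by
  rw [mem_spotBlock] at hs
  have hl : ({a | a ≤ s ∧ ∀ t, a ≤ t → t < s → t ∈ (spotBlock n i (m + 1)).erase s} :
      Finset (Fin n)) = spotBlock n i ((s : ℕ) - i + 1) := by
    ext a
    simp only [mem_filter, mem_univ, true_and, mem_erase, mem_spotBlock]
    constructor
    · rintro ⟨h1, h2⟩
      rcases eq_or_lt_of_le h1 with rfl | h1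
      · omega
      · have := h2 a le_rfl h1
        rw [Fin.lt_def] at h1
        omega
    · intro h1
      refine ⟨by rw [Fin.le_def]; omega, fun t h2 h3 => ⟨h3.ne, ?_⟩⟩
      rw [Fin.le_def] at h2
      rw [Fin.lt_def] at h3
      omega
  have hr : ({a | s ≤ a ∧ ∀ t, s < t → t ≤ a → t ∈ (spotBlock n i (m + 1)).erase s} :
      Finset (Fin n)) = spotBlock n s (m - ((s : ℕ) - i) + 1) := by
    ext a
    simp only [mem_filter, mem_univ, true_and, mem_erase, mem_spotBlock]
    constructor
    · rintro ⟨h1, h2⟩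
      rcases eq_or_lt_of_le h1 with rfl | h1
      · omega
      · have := h2 a h1 le_rfl
        rw [Fin.lt_def] at h1
        omega
    · intro h1
      refine ⟨by rw [Fin.le_def]; omega, fun t h2 h3 => ⟨h2.ne', ?_⟩⟩
      rw [Fin.lt_def] at h2
      rw [Fin.le_def] at h3
      omega
  rw [spotWeight, hl, hr, card_spotBlock (by omega), card_spotBlock (by omega)]
  push_cast
  ring

/-- The number of preference vectors for `m` cars on `m + 1` spots which leave the spot with `k`
spots on its left empty. -/
def splitCount (m k : ℕ) : ℝ := (m.choose k : ℝ) * (parkCount k * parkCount (m - k))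

lemma splitCount_sub {k : ℕ} (hk : k ≤ m) : splitCount m (m - k) = splitCount m k := by
  rw [splitCount, splitCount, Nat.choose_symm hk, Nat.sub_sub_self hk, mul_comm (parkCount k)]

lemma sum_splitCount_mul (p : ℝ) (m : ℕ) :
    ∑ k ∈ range (m + 1), splitCount m k * (p * ((k : ℝ) + 1) + (1 - p) * ((m - k : ℕ) + 1)) =
      parkCount (m + 1) := by
  have hrefl : ∑ k ∈ range (m + 1), splitCount m k * (((m - k : ℕ) : ℝ) + 1) =
      ∑ k ∈ range (m + 1), splitCount m k * ((k : ℝ) + 1) := by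
    rw [← sum_range_reflect]
    refine sum_congr rfl fun k hk => ?_
    have hk' : k ≤ m := by simpa [Nat.lt_succ_iff] using hk
    rw [Nat.add_sub_cancel, splitCount_sub hk', Nat.sub_sub_self hk']
  have htot : ∑ k ∈ range (m + 1), splitCount m k * (((m - k : ℕ) : ℝ) + 1) +
      ∑ k ∈ range (m + 1), splitCount m k * ((k : ℝ) + 1) = 2 * ((m : ℝ) + 2) ^ m := by
    rw [← sum_choose_mul_parkCount_mul_parkCount, ← sum_add_distrib, mul_sum]
    refine sum_congr rfl fun k hk => ?_
    have hk' : k ≤ m := by simpa [Nat.lt_succ_iff] using hk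
    rw [Nat.cast_sub hk', splitCount]
    ring
  have hsplit : ∑ k ∈ range (m + 1),
      splitCount m k * (p * ((k : ℝ) + 1) + (1 - p) * ((m - k : ℕ) + 1)) =
      p * ∑ k ∈ range (m + 1), splitCount m k * ((k : ℝ) + 1) +
      (1 - p) * ∑ k ∈ range (m + 1), splitCount m k * (((m - k : ℕ) : ℝ) + 1) := by
    rw [mul_sum, mul_sum, ← sum_add_distrib]
    exact sum_congr rfl fun k _ => by ring
  have hpc : parkCount (m + 1) = ((m : ℝ) + 2) ^ m := by
    rw [parkCount, Nat.add_sub_cancel]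
    push_cast
    ring
  rw [hsplit, hpc, hrefl]
  linarith

lemma parkWeight_spotBlock_erase (p : ℝ) {i : ℕ}
    (ih : ∀ k ≤ m, ∀ i, i + k ≤ n → parkWeight n p k (spotBlock n i k) = parkCount k)
    (h : i + (m + 1) ≤ n) {s : Fin n} (hs : s ∈ spotBlock n i (m + 1)) :
    parkWeight n p m ((spotBlock n i (m + 1)).erase s) = splitCount m ((s : ℕ) - i) := by
  rw [mem_spotBlock] at hs
  have hl : ((spotBlock n i (m + 1)).erase s).filter (· < s) = spotBlock n i ((s : ℕ) - i) := by
    ext a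
    simp only [mem_filter, mem_erase, mem_spotBlock, Fin.lt_def, ne_eq, Fin.ext_iff]
    omega
  have hr : ((spotBlock n i (m + 1)).erase s).filter (s < ·) =
      spotBlock n (s + 1) (m - ((s : ℕ) - i)) := by
    ext a
    simp only [mem_filter, mem_erase, mem_spotBlock, Fin.lt_def, ne_eq, Fin.ext_iff]
    omega
  have := parkWeight_split p (notMem_erase s (spotBlock n i (m + 1)))
    (by rw [hl, card_spotBlock (by omega)]) (by rw [hr, card_spotBlock (by omega)])
  rw [hl, hr, ih _ (by omega) _ (by omega), ih _ (by omega) _ (by omega),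
    Nat.add_sub_cancel' (by omega)] at this
  exact this

/-- The weight of a full block of spots does not depend on `p`. -/
theorem parkWeight_spotBlock (p : ℝ) {i : ℕ} (h : i + m ≤ n) :
    parkWeight n p m (spotBlock n i m) = parkCount m := by
  induction m using Nat.strong_induction_on generalizing i with
  | _ m ih =>
    rcases m with _ | m
    · have : spotBlock n i 0 = ∅ := card_eq_zero.1 (card_spotBlock h)
      rw [this, parkWeight_zero]
      simp [parkCount]
    · rw [parkWeight_succ, ← sum_splitCount_mul p]
      refine sum_bij (fun s _ => (s : ℕ) - i) ?_ ?_ ?_ ?_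
      · intro s hs
        rw [mem_spotBlock] at hs
        simp only [mem_range]
        omega
      · intro s hs t ht hst
        rw [mem_spotBlock] at hs ht
        exact Fin.ext (by omega)
      · intro k hk
        rw [mem_range] at hk
        exact ⟨⟨i + k, by omega⟩, by rw [mem_spotBlock]; simp only; omega, by simp⟩
      · intro s hs
        rw [spotWeight_spotBlock_erase p h hs, parkWeight_spotBlock_erase p
          (fun k hk i hik => ih k (by omega) hik) h hs]

lemma spotBlock_zero_self : spotBlock n 0 n = univ := by
  ext x
  simp [mem_spotBlock]

lemma parkWeight_compl_singleton (p : ℝ) (e : Fin (n + 1)) :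
    parkWeight (n + 1) p n {e}ᶜ = splitCount n e := by
  have h : ({e}ᶜ : Finset (Fin (n + 1))) = (spotBlock (n + 1) 0 (n + 1)).erase e := by
    rw [spotBlock_zero_self, compl_singleton]
  rw [h, parkWeight_spotBlock_erase p (fun k _ i hik => parkWeight_spotBlock p hik)
    (by omega) (by rw [spotBlock_zero_self]; exact mem_univ e), Nat.sub_zero]

lemma sum_coinWeight_mul_linParks (n : ℕ) (p : ℝ) :
    ∑ α : Fin n → Fin n, ∑ c : Fin n → Bool,
      coinWeight p c * (if linParks n n α c then 1 else 0) = parkCount n := by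
  unfold linParks
  rw [sum_coinWeight_mul p (fun o => if o.isSome = true then 1 else 0) (by simp)]
  rw [sum_eq_single univ]
  · rw [← spotBlock_zero_self, parkWeight_spotBlock p (by omega)]
    simp
  · intro S _ hS
    rw [parkWeight_eq_zero, zero_mul]
    intro h
    exact hS (card_eq_iff_eq_univ S |>.1 (by simpa using h))
  · simp

lemma sum_parkWeight_mul (p : ℝ) (G : Finset (Fin (n + 1)) → ℝ) :
    ∑ S, parkWeight (n + 1) p n S * G S = ∑ e : Fin (n + 1), splitCount n e * G {e}ᶜ := by
  symm
  refine sum_of_injOn (fun e => {e}ᶜ) ?_ (by simp) ?_ ?_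
  · intro a _ b _ hab
    simpa using hab
  · intro S _ hS
    rw [parkWeight_eq_zero, zero_mul]
    intro hc
    have h1 : #Sᶜ = 1 := by rw [card_compl, hc]; simp
    obtain ⟨e, he⟩ := card_eq_one.1 h1
    exact hS ⟨e, by simp, by simp [← he]⟩
  · intro e _
    rw [parkWeight_compl_singleton]

lemma isSome_linPark_compl_singleton (e a : Fin n) (b : Bool) :
    (linPark n {e}ᶜ a b).isSome ↔ if b then a ≤ e else e ≤ a := by
  rw [Option.isSome_iff_exists]
  simp only [linPark_eq_some_iff, mem_compl, mem_singleton, not_not, exists_eq_left]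
  split_ifs
  · exact and_iff_left fun t _ h => h.ne
  · exact and_iff_left fun t h _ => h.ne'

lemma sum_coinWeight_mul_last_eq (n : ℕ) (p : ℝ) (a : Fin (n + 1)) :
    ∑ α : Fin (n + 1) → Fin (n + 1), ∑ c : Fin (n + 1) → Bool,
      coinWeight p c * (if linParks (n + 1) (n + 1) α c ∧ α (Fin.last n) = a then 1 else 0) =
      p * ∑ s ∈ range (n + 1 - a), splitCount n s +
      (1 - p) * ∑ s ∈ Ico (n - a) (n + 1), splitCount n s := by
  unfold linParks
  rw [sum_coinWeight_mul_last p (fun x o => if o.isSome = true ∧ x = a then 1 else 0) (by simp),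
    sum_parkWeight_mul]
  simp only [Option.isSome_map, isSome_linPark_compl_singleton, Fintype.sum_bool, flipWeight,
    if_true, Bool.false_eq_true, if_false, sum_add_distrib, ite_and, mul_ite, mul_one, mul_zero]
  have := a.isLt
  have hf : ∀ e : Fin (n + 1), splitCount n e * (∑ x, (if x ≤ e then if x = a then p else 0 else 0)
      + ∑ x, if e ≤ x then if x = a then 1 - p else 0 else 0) =
      (fun k : ℕ => splitCount n k * ((if (a : ℕ) ≤ k then p else 0) +
        if k ≤ (a : ℕ) then 1 - p else 0)) e := by
    intro e
    rw [Fintype.sum_eq_single a fun x hx => by simp [hx],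
      Fintype.sum_eq_single a fun x hx => by simp [hx]]
    simp only [if_true, Fin.le_def]
  rw [sum_congr rfl fun e _ => hf e, Fin.sum_univ_eq_sum_range
    (fun k : ℕ => splitCount n k * ((if (a : ℕ) ≤ k then p else 0) +
        if k ≤ (a : ℕ) then 1 - p else 0)), ← sum_range_reflect]
  have h1 : range (n + 1 - a) = {s ∈ range (n + 1) | s ≤ n - a} := by
    ext s
    simp only [mem_range, mem_filter]
    omega
  have h2 : Ico (n - a) (n + 1) = {s ∈ range (n + 1) | n - a ≤ s} := by
    ext s
    simp only [mem_range, mem_filter, mem_Ico]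
    omega
  rw [h1, h2, sum_filter, sum_filter, mul_sum, mul_sum, ← sum_add_distrib]
  refine sum_congr rfl fun s hs => ?_
  rw [mem_range] at hs
  have e1 : (a : ℕ) ≤ n - s ↔ s ≤ n - a := by omega
  have e2 : n - s ≤ (a : ℕ) ↔ n - a ≤ s := by omega
  rw [Nat.add_sub_cancel, splitCount_sub (by omega)]
  simp only [e1, e2]
  split_ifs <;> ring

lemma parkCount_eq_zpow (m : ℕ) : parkCount m = ((m : ℝ) + 1) ^ ((m : ℤ) - 1) := by
  rcases m with _ | m
  · simp [parkCount]
  · simp [parkCount]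

lemma abelTerm_succ {s : ℕ} (hs : s ≤ n) : abelTerm (n + 1) s = splitCount n s := by
  rw [abelTerm, splitCount, parkCount_eq_zpow, parkCount_eq_zpow, Nat.add_sub_cancel,
    Nat.cast_sub hs, Nat.cast_sub hs, mul_assoc, mul_comm (_ ^ ((s : ℤ) - 1))]
  have e1 : ((n + 1 : ℕ) : ℝ) - s = (n : ℝ) - s + 1 := by push_cast; ring
  have e2 : ((n + 1 : ℕ) : ℤ) - s - 2 = (n : ℤ) - s - 1 := by push_cast; ring
  rw [e1, e2]

end Protocol

/-- **Theorem 3.** Under the probabilistic parking protocol with parameter `p` on `n`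
spots, given that the uniformly random preference vector `α ∈ [n]^n` is a parking
function, the conditional probability that the last car prefers spot `j` equals
`2/(n+1) − (1/(n+1)^{n−1})[p·Σ_{s=n−j+1}^{n−1} C(n−1,s)(n−s)^{n−s−2}(s+1)^{s−1}`
`+ (1−p)·Σ_{s=0}^{n−j−1} C(n−1,s)(n−s)^{n−s−2}(s+1)^{s−1}]`. -/
theorem last_car_preference (n : ℕ) (hn : 0 < n) (p : ℝ) (hp0 : 0 ≤ p) (hp1 : p ≤ 1)
    (j : ℕ) (hj1 : 1 ≤ j) (hjn : j ≤ n) :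
    (∑ α : Fin n → Fin n, ∑ c : Fin n → Bool,
        coinWeight p c *
          (if linParks n n α c ∧ (α ⟨n - 1, by omega⟩ : ℕ) + 1 = j then 1 else 0)) /
      (∑ α : Fin n → Fin n, ∑ c : Fin n → Bool,
        coinWeight p c * (if linParks n n α c then 1 else 0))
      = Qform n p j := by
  obtain ⟨n, rfl⟩ := Nat.exists_eq_succ_of_ne_zero hn.ne'
  obtain ⟨a, rfl⟩ := Nat.exists_eq_add_of_le' hj1
  simp only [Nat.succ_eq_add_one] at *
  have hlast : ∀ α : Fin (n + 1) → Fin (n + 1),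
      (α ⟨n + 1 - 1, by omega⟩ : ℕ) + 1 = a + 1 ↔ α (Fin.last n) = ⟨a, by omega⟩ := by
    intro α
    rw [Nat.add_right_cancel_iff, Fin.ext_iff]
    rfl
  simp only [hlast]
  rw [sum_coinWeight_mul_last_eq, sum_coinWeight_mul_linParks, Qform]
  have hI : ∑ s ∈ Icc (n + 1 - (a + 1) + 1) (n + 1 - 1), abelTerm (n + 1) s =
      ∑ s ∈ Ico (n + 1 - a) (n + 1), splitCount n s := by
    refine sum_congr ?_ fun s hs => abelTerm_succ ?_
    · ext s
      simp only [mem_Icc, mem_Ico]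
      omega
    · simp only [mem_Ico] at hs
      omega
  have hR : ∑ s ∈ range (n + 1 - (a + 1)), abelTerm (n + 1) s =
      ∑ s ∈ range (n - a), splitCount n s := by
    refine sum_congr (by congr 1; omega) fun s hs => abelTerm_succ ?_
    simp only [mem_range] at hs
    omega
  have h1 := sum_range_add_sum_Ico (splitCount n) (show n + 1 - a ≤ n + 1 by omega)
  have h2 := sum_range_add_sum_Ico (splitCount n) (show n - a ≤ n + 1 by omega)
  have htot := sum_choose_mul_parkCount_mul_parkCount n
  have hpos : (n : ℝ) + 2 ≠ 0 := by positivity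
  have hcast : ((n + 1 : ℕ) : ℝ) + 1 = n + 2 := by push_cast; ring
  rw [hI, hR, parkCount, Nat.add_sub_cancel, hcast, eq_sub_of_add_eq h1, eq_sub_of_add_eq' h2]
  simp only [splitCount] at *
  rw [eq_div_of_mul_eq hpos ((mul_comm _ _).trans htot)]
  field_simp
  ring
end
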